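/- Let θ be a real number and G a graph. If X is a θ-barrier set of G, x ∈ X, and P_θ(G\x)=∅, then A_θ(G\x) = X\{x}. -/

import Mathlib

open Polynomial

namespace MatchPoly

variable {V : Type*}

/-- The number of `r`-matchings in `G`: sets of `r` edges, no two sharing a vertex. -/
noncomputable def numMatchings (G : SimpleGraph V) (r : ℕ) : ℕ :=
  Nat.card {M : Finset (Sym2 V) // M.card = r ∧ (M : Set (Sym2 V)) ⊆ G.edgeSet ∧
    (M : Set (Sym2 V)).Pairwise fun e f => ∀ v : V, v ∈ e → v ∉ f}

/-- The matching polynomial `μ(G,x) = ∑ (-1)^r p(G,r) x^(n-2r)`. -/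
noncomputable def matchingPoly (G : SimpleGraph V) : Polynomial ℝ :=
  ∑ r ∈ Finset.range (Nat.card V + 1),
    Polynomial.C ((-1 : ℝ) ^ r * (numMatchings G r : ℝ)) *
      (Polynomial.X : Polynomial ℝ) ^ (Nat.card V - 2 * r)

/-- `mult θ G`: the multiplicity of `θ` as a root of `μ(G,x)`. -/
noncomputable def mult (θ : ℝ) (G : SimpleGraph V) : ℕ :=
  (matchingPoly G).rootMultiplicity θ

/-- `G \ X`: the induced subgraph on the complement of the vertex set `X`. -/
def deleteSet (G : SimpleGraph V) (X : Set V) : SimpleGraph ↥(Xᶜ) :=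
  G.induce (Xᶜ)

/-- `G \ v`: delete a single vertex. -/
def deleteVert (G : SimpleGraph V) (v : V) : SimpleGraph ↥({v}ᶜ : Set V) :=
  G.induce ({v}ᶜ : Set V)

/-- `u` is θ-essential: `mult(θ, G\u) = mult(θ,G) - 1`. -/
def IsEssential (θ : ℝ) (G : SimpleGraph V) (u : V) : Prop :=
  mult θ (deleteVert G u) + 1 = mult θ G

/-- `u` is θ-neutral: `mult(θ, G\u) = mult(θ,G)`. -/
def IsNeutral (θ : ℝ) (G : SimpleGraph V) (u : V) : Prop :=
  mult θ (deleteVert G u) = mult θ G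

/-- `u` is θ-positive: `mult(θ, G\u) = mult(θ,G) + 1`. -/
def IsPositive (θ : ℝ) (G : SimpleGraph V) (u : V) : Prop :=
  mult θ (deleteVert G u) = mult θ G + 1

/-- `u` is θ-special: not θ-essential but adjacent to a θ-essential vertex. -/
def IsSpecial (θ : ℝ) (G : SimpleGraph V) (u : V) : Prop :=
  ¬ IsEssential θ G u ∧ ∃ w : V, G.Adj u w ∧ IsEssential θ G w

/-- `A_θ(G)`: the set of θ-special vertices. -/
def specialSet (θ : ℝ) (G : SimpleGraph V) : Set V := {u | IsSpecial θ G u}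

/-- `N_θ(G)`: the set of θ-neutral vertices. -/
def neutralSet (θ : ℝ) (G : SimpleGraph V) : Set V := {u | IsNeutral θ G u}

/-- `P_θ(G)`: the set of θ-positive vertices that are not θ-special. -/
def positiveSet (θ : ℝ) (G : SimpleGraph V) : Set V :=
  {u | IsPositive θ G u ∧ ¬ IsSpecial θ G u}

/-- `G` is θ-super positive: `mult(θ,G) = 0` and `mult(θ,G\v) = 1` for every vertex `v`. -/
def IsSuperPositive (θ : ℝ) (G : SimpleGraph V) : Prop :=
  mult θ G = 0 ∧ ∀ v : V, mult θ (deleteVert G v) = 1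

/-- `G` is θ-elementary: θ-super positive and `P_θ(G\v) = ∅` for every vertex `v`. -/
def IsElementary (θ : ℝ) (G : SimpleGraph V) : Prop :=
  IsSuperPositive θ G ∧ ∀ v : V, positiveSet θ (deleteVert G v) = ∅

/-- `G` is θ-critical: every vertex is θ-essential and `mult(θ,G) = 1`. -/
def IsCritical (θ : ℝ) (G : SimpleGraph V) : Prop :=
  (∀ v : V, IsEssential θ G v) ∧ mult θ G = 1

/-- `c_θ(G)`: the number of θ-critical connected components of `G`. -/
noncomputable def numCritComponents (θ : ℝ) (G : SimpleGraph V) : ℕ :=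
  Nat.card {c : G.ConnectedComponent // IsCritical θ (G.induce c.supp)}

/-- `X` is a θ-barrier set: `mult(θ,G) = c_θ(G\X) - |X|`. -/
def IsBarrier (θ : ℝ) (G : SimpleGraph V) (X : Set V) : Prop :=
  numCritComponents θ (deleteSet G X) = mult θ G + X.ncard

/-- `X` is a θ-extreme set: `mult(θ,G\X) = mult(θ,G) + |X|`. -/
def IsExtreme (θ : ℝ) (G : SimpleGraph V) (X : Set V) : Prop :=
  mult θ (deleteSet G X) = mult θ G + X.ncard

/-- `G` is θ-base: θ-super positive and no θ-barrier set contains two adjacent vertices. -/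
def IsBase (θ : ℝ) (G : SimpleGraph V) : Prop :=
  IsSuperPositive θ G ∧
    ∀ X : Set V, IsBarrier θ G X → ∀ u v : V, u ∈ X → v ∈ X → ¬ G.Adj u v

section Matchings

open Classical

/-- The neighbours of `u` inside `S`. -/
noncomputable def nbrsIn (G : SimpleGraph V) (S : Finset V) (u : V) : Finset V :=
  S.filter fun i => G.Adj u i

theorem mem_nbrsIn {G : SimpleGraph V} {S : Finset V} {u i : V} :
    i ∈ nbrsIn G S u ↔ i ∈ S ∧ G.Adj u i := by
  simp [nbrsIn]

variable {G : SimpleGraph V} {S : Finset V} {u v w : V}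

theorem nbrsIn_erase : nbrsIn G (S.erase v) u = (nbrsIn G S u).erase v := by
  simp [nbrsIn, Finset.filter_erase]

theorem sum_nbrsIn (hv : v ∈ S) (f : V → ℝ[X]) :
    ∑ i ∈ nbrsIn G S u, f i =
      (if G.Adj u v then f v else 0) + ∑ i ∈ (nbrsIn G S u).erase v, f i := by
  split_ifs with h
  · rw [Finset.add_sum_erase _ _ (mem_nbrsIn.2 ⟨hv, h⟩)]
  · rw [Finset.erase_eq_of_notMem (fun h' => h (mem_nbrsIn.1 h').2), zero_add]

theorem range_induce (s : Set V) :
    Set.range (SimpleGraph.Embedding.induce s : G.induce s ↪g G) = s :=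
  Subtype.range_coe

variable [Fintype V]

/-- The matchings of `G` all of whose edges lie inside the vertex set `S`. -/
noncomputable def matchingsIn (G : SimpleGraph V) (S : Finset V) : Finset (Finset (Sym2 V)) :=
  Finset.univ.filter fun M => (M : Set (Sym2 V)) ⊆ G.edgeSet ∧
    ((M : Set (Sym2 V)).Pairwise fun e f => ∀ v : V, v ∈ e → v ∉ f) ∧ ∀ e ∈ M, ∀ v ∈ e, v ∈ S

/-- The matching polynomial of the subgraph of `G` induced on `S`. -/
noncomputable def polyOn (G : SimpleGraph V) (S : Finset V) : ℝ[X] :=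
  ∑ M ∈ matchingsIn G S, C ((-1 : ℝ) ^ M.card) * X ^ (S.card - 2 * M.card)

theorem mem_matchingsIn {G : SimpleGraph V} {S : Finset V} {M : Finset (Sym2 V)} :
    M ∈ matchingsIn G S ↔ (M : Set (Sym2 V)) ⊆ G.edgeSet ∧
      ((M : Set (Sym2 V)).Pairwise fun e f => ∀ v : V, v ∈ e → v ∉ f) ∧
      ∀ e ∈ M, ∀ v ∈ e, v ∈ S := by
  simp [matchingsIn]

theorem two_mul_card_le {G : SimpleGraph V} {S : Finset V} {M : Finset (Sym2 V)}
    (hM : M ∈ matchingsIn G S) : 2 * M.card ≤ S.card := by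
  obtain ⟨hE, hd, hS⟩ := mem_matchingsIn.1 hM
  have h : (M.biUnion fun e => e.toFinset).card = ∑ e ∈ M, e.toFinset.card := by
    refine Finset.card_biUnion fun e he f hf hef => ?_
    refine Finset.disjoint_left.2 ?_
    intro v hv hv'
    exact hd he hf hef v (Sym2.mem_toFinset.1 hv) (Sym2.mem_toFinset.1 hv')
  have h2 : ∑ e ∈ M, e.toFinset.card = M.card * 2 :=
    Finset.sum_const_nat fun e he =>
      Sym2.card_toFinset_of_not_isDiag e (G.not_isDiag_of_mem_edgeSet (hE he))
  have h3 : (M.biUnion fun e => e.toFinset) ⊆ S := by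
    intro v hv
    obtain ⟨e, he, hv⟩ := Finset.mem_biUnion.1 hv
    exact hS e he v (Sym2.mem_toFinset.1 hv)
  have := Finset.card_le_card h3
  omega

theorem numMatchings_eq_card {W : Type*} {H : SimpleGraph W} {G : SimpleGraph V} (f : H ↪g G)
    (S : Finset V) (hS : Set.range f = S) (r : ℕ) :
    numMatchings H r = ((matchingsIn G S).filter fun M => M.card = r).card := by
  let φ : Sym2 W ↪ Sym2 V := f.toEmbedding.sym2Map
  have hmem : ∀ (e : Sym2 W) (v : V), v ∈ φ e ↔ ∃ w ∈ e, f w = v := fun e v => Sym2.mem_map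
  have hedge : ∀ e : Sym2 W, φ e ∈ G.edgeSet ↔ e ∈ H.edgeSet := by
    intro e
    induction e with
    | _ a b => exact f.map_adj_iff
  have hφ : ∀ M : Finset (Sym2 W), M.map φ ∈ matchingsIn G S ↔ (M : Set (Sym2 W)) ⊆ H.edgeSet ∧
      (M : Set (Sym2 W)).Pairwise fun e f => ∀ v : W, v ∈ e → v ∉ f := by
    intro M
    rw [mem_matchingsIn]
    constructor
    · rintro ⟨h1, h2, -⟩
      refine ⟨fun e he => (hedge e).1 (h1 (by simpa using he)), fun e he e' he' hne v hv hv' => ?_⟩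
      exact h2 (x := φ e) (by simpa using he) (y := φ e') (by simpa using he')
        (φ.injective.ne hne) (f v) ((hmem _ _).2 ⟨v, hv, rfl⟩) ((hmem _ _).2 ⟨v, hv', rfl⟩)
    · rintro ⟨h1, h2⟩
      refine ⟨?_, ?_, ?_⟩
      · intro e he
        obtain ⟨e, hM, rfl⟩ := Finset.mem_map.1 he
        exact (hedge e).2 (h1 (Finset.mem_coe.2 hM))
      · intro e he e' he' hne v hv hv'
        obtain ⟨e, hM, rfl⟩ := Finset.mem_map.1 he
        obtain ⟨e', hM', rfl⟩ := Finset.mem_map.1 he'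
        obtain ⟨w, hw, rfl⟩ := (hmem _ _).1 hv
        obtain ⟨w', hw', h⟩ := (hmem _ _).1 hv'
        exact h2 (Finset.mem_coe.2 hM) (Finset.mem_coe.2 hM') (fun h => hne (congrArg φ h)) w hw
          (f.injective h ▸ hw')
      · intro e he v hv
        obtain ⟨e, hM, rfl⟩ := Finset.mem_map.1 he
        obtain ⟨w, hw, rfl⟩ := (hmem _ _).1 hv
        exact Finset.mem_coe.1 (hS ▸ Set.mem_range_self w)
  rw [numMatchings, ← Nat.card_eq_finsetCard]
  refine Nat.card_congr (Equiv.ofBijective (fun M => ⟨M.1.map φ, ?_⟩) ⟨?_, ?_⟩)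
  · exact Finset.mem_filter.2 ⟨(hφ _).2 M.2.2, by simpa using M.2.1⟩
  · intro M M' h
    exact Subtype.ext (Finset.map_injective φ (Subtype.ext_iff.1 h))
  · rintro ⟨M, hM⟩
    obtain ⟨hM, hr⟩ := Finset.mem_filter.1 hM
    have hrange : ∀ e ∈ M, e ∈ Set.range φ := by
      intro e he
      have h := (mem_matchingsIn.1 hM).2.2 e he
      induction e with
      | _ a b =>
        obtain ⟨a', rfl⟩ : a ∈ Set.range f := hS ▸ Finset.mem_coe.2 (h a (Sym2.mem_mk_left _ _))
        obtain ⟨b', rfl⟩ : b ∈ Set.range f := hS ▸ Finset.mem_coe.2 (h b (Sym2.mem_mk_right _ _))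
        exact ⟨s(a', b'), rfl⟩
    have hmap : (M.preimage φ φ.injective.injOn).map φ = M := by
      ext e
      rw [Finset.mem_map]
      constructor
      · rintro ⟨e, he, rfl⟩
        exact Finset.mem_preimage.1 he
      · intro he
        obtain ⟨e, rfl⟩ := hrange e he
        exact ⟨e, Finset.mem_preimage.2 he, rfl⟩
    refine ⟨⟨M.preimage φ φ.injective.injOn, ?_, ?_⟩, Subtype.ext hmap⟩
    · rw [← hr, ← Finset.card_map φ, hmap]
    · rw [← hφ, hmap]
      exact hM

theorem matchingPoly_eq_polyOn {W : Type*} {H : SimpleGraph W} {G : SimpleGraph V} (f : H ↪g G)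
    (S : Finset V) (hS : Set.range f = S) : matchingPoly H = polyOn G S := by
  have hcard : Nat.card W = S.card := by
    rw [← Nat.card_range_of_injective f.injective, hS]
    simp
  have hmaps : ∀ M ∈ matchingsIn G S, M.card ∈ Finset.range (Nat.card W + 1) := by
    intro M hM
    have := two_mul_card_le hM
    rw [Finset.mem_range]
    omega
  rw [matchingPoly, polyOn, ← Finset.sum_fiberwise_of_maps_to hmaps]
  refine Finset.sum_congr rfl fun r _ => ?_
  rw [numMatchings_eq_card f S hS r, Finset.sum_congr rfl (g := fun _ =>
    C ((-1 : ℝ) ^ r) * X ^ (S.card - 2 * r))]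
  · rw [Finset.sum_const, hcard, nsmul_eq_mul]
    simp only [map_mul, map_natCast]
    ring
  · intro M hM
    rw [(Finset.mem_filter.1 hM).2]

theorem matchingsIn_filter_not_covered {G : SimpleGraph V} {S : Finset V} {u : V} :
    (matchingsIn G S).filter (fun M => ¬ ∃ e ∈ M, u ∈ e) = matchingsIn G (S.erase u) := by
  ext M
  simp only [Finset.mem_filter, mem_matchingsIn, Finset.mem_erase]
  constructor
  · rintro ⟨⟨h1, h2, h3⟩, h4⟩
    exact ⟨h1, h2, fun e he v hv => ⟨fun h => h4 ⟨e, he, h ▸ hv⟩, h3 e he v hv⟩⟩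
  · rintro ⟨h1, h2, h3⟩
    exact ⟨⟨h1, h2, fun e he v hv => (h3 e he v hv).2⟩, fun ⟨e, he, hu⟩ => (h3 e he u hu).1 rfl⟩

theorem matchingsIn_filter_covered {G : SimpleGraph V} {S : Finset V} {u : V} (hu : u ∈ S) :
    (matchingsIn G S).filter (fun M => ∃ e ∈ M, u ∈ e) =
      (nbrsIn G S u).biUnion fun i =>
        (matchingsIn G ((S.erase u).erase i)).image (insert s(u, i)) := by
  ext M
  simp only [Finset.mem_filter, Finset.mem_biUnion, Finset.mem_image, mem_nbrsIn]
  constructor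
  · rintro ⟨hM, e, he, hue⟩
    obtain ⟨h1, h2, h3⟩ := mem_matchingsIn.1 hM
    obtain ⟨i, rfl⟩ := Sym2.mem_iff_exists.1 hue
    refine ⟨i, ⟨h3 _ he i (Sym2.mem_mk_right _ _), h1 he⟩, M.erase s(u, i), ?_,
      Finset.insert_erase he⟩
    refine mem_matchingsIn.2 ⟨fun e' he' => h1 (Finset.mem_of_mem_erase he'),
      h2.mono fun e' he' => Finset.mem_of_mem_erase he', fun e' he' v hv => ?_⟩
    obtain ⟨hne, hM'⟩ := Finset.mem_erase.1 he'
    refine Finset.mem_erase.2 ⟨?_, Finset.mem_erase.2 ⟨?_, h3 _ hM' v hv⟩⟩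
    · rintro rfl
      exact h2 (Finset.mem_coe.2 hM') he hne v hv (Sym2.mem_mk_right _ _)
    · rintro rfl
      exact h2 (Finset.mem_coe.2 hM') he hne v hv (Sym2.mem_mk_left _ _)
  · rintro ⟨i, ⟨hi, hui⟩, M, hM, rfl⟩
    obtain ⟨h1, h2, h3⟩ := mem_matchingsIn.1 hM
    have hui' : ∀ e ∈ M, ∀ v ∈ e, v ∉ s(u, i) := by
      intro e he v hv hv'
      have := h3 e he v hv
      simp only [Finset.mem_erase] at this
      rcases Sym2.mem_iff.1 hv' with rfl | rfl <;> tauto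
    refine ⟨mem_matchingsIn.2 ⟨?_, ?_, ?_⟩, s(u, i), Finset.mem_insert_self _ _,
      Sym2.mem_mk_left _ _⟩
    · intro e he
      rcases Finset.mem_insert.1 he with rfl | he
      exacts [hui, h1 he]
    · rw [Finset.coe_insert]
      exact h2.insert fun e he _ => ⟨fun v hv hv' => hui' e he v hv' hv, hui' e he⟩
    · intro e he v hv
      rcases Finset.mem_insert.1 he with rfl | he
      · rcases Sym2.mem_iff.1 hv with rfl | rfl <;> assumption
      · exact Finset.mem_of_mem_erase (Finset.mem_of_mem_erase (h3 e he v hv))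

theorem notMem_of_mem_matchingsIn {G : SimpleGraph V} {S : Finset V} {u : V} {M : Finset (Sym2 V)}
    (hM : M ∈ matchingsIn G S) (hu : u ∉ S) {e : Sym2 V} (he : u ∈ e) : e ∉ M :=
  fun h => hu ((mem_matchingsIn.1 hM).2.2 e h u he)

/-- Expansion of the matching polynomial along the vertex `u`. -/
theorem polyOn_eq {G : SimpleGraph V} {S : Finset V} {u : V} (hu : u ∈ S) :
    polyOn G S = X * polyOn G (S.erase u) -
      ∑ i ∈ nbrsIn G S u, polyOn G ((S.erase u).erase i) := by
  have hcard : (S.erase u).card + 1 = S.card := Finset.card_erase_add_one hu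
  have hnot : ∀ i, ∀ M ∈ matchingsIn G ((S.erase u).erase i), ∀ j, s(u, j) ∉ M :=
    fun i M hM j => notMem_of_mem_matchingsIn hM (by simp) (Sym2.mem_mk_left u j)
  rw [polyOn, ← Finset.sum_filter_add_sum_filter_not _ (fun M => ∃ e ∈ M, u ∈ e),
    matchingsIn_filter_not_covered, matchingsIn_filter_covered hu, add_comm, sub_eq_add_neg]
  congr 1
  · rw [polyOn, Finset.mul_sum]
    refine Finset.sum_congr rfl fun M hM => ?_
    have := two_mul_card_le hM
    rw [show S.card - 2 * M.card = (S.erase u).card - 2 * M.card + 1 by omega]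
    ring
  · rw [Finset.sum_biUnion, ← Finset.sum_neg_distrib]
    · refine Finset.sum_congr rfl fun i hi => ?_
      have hi' : ((S.erase u).erase i).card + 1 = (S.erase u).card :=
        Finset.card_erase_add_one (Finset.mem_erase.2
          ⟨(mem_nbrsIn.1 hi).2.ne', (mem_nbrsIn.1 hi).1⟩)
      rw [Finset.sum_image, polyOn, ← Finset.sum_neg_distrib]
      · refine Finset.sum_congr rfl fun M hM => ?_
        rw [Finset.card_insert_of_notMem (hnot i M hM i), pow_succ,
          show S.card - 2 * (M.card + 1) = ((S.erase u).erase i).card - 2 * M.card by omega]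
        simp
      · intro M hM M' hM' h
        rw [← Finset.erase_insert (hnot i M hM i), ← Finset.erase_insert (hnot i M' hM' i)]
        exact congrArg (fun N => N.erase s(u, i)) h
    · intro i hi j hj hij
      refine Finset.disjoint_left.2 fun M hM hM' => ?_
      obtain ⟨N, hN, rfl⟩ := Finset.mem_image.1 hM
      obtain ⟨N', hN', h⟩ := Finset.mem_image.1 hM'
      have h1 : s(u, i) ∈ insert s(u, j) N' := h ▸ Finset.mem_insert_self _ _
      rcases Finset.mem_insert.1 h1 with h1 | h1
      · exact hij (Sym2.congr_right.1 h1)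
      · exact hnot j N' hN' i h1

theorem IsSumSq.eval_nonneg {p : ℝ[X]} (hp : IsSumSq p) (c : ℝ) : 0 ≤ p.eval c := by
  induction hp with
  | zero => simp
  | sq_add a _ ih =>
    rw [eval_add, eval_mul]
    exact add_nonneg (mul_self_nonneg _) ih

theorem IsSumSq.exists_eq_of_isRoot {p : ℝ[X]} (hp : IsSumSq p) {c : ℝ} (hc : p.IsRoot c) :
    ∃ q, IsSumSq q ∧ p = (X - C c) ^ 2 * q := by
  induction hp with
  | zero => exact ⟨0, .zero, by simp⟩
  | @sq_add a s hs ih =>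
    have h0 : a.eval c * a.eval c + s.eval c = 0 := by simpa using hc
    have h1 := IsSumSq.eval_nonneg hs c
    have ha : a.IsRoot c := mul_self_eq_zero.1 (by nlinarith [mul_self_nonneg (a.eval c)])
    obtain ⟨q, hq, rfl⟩ := ih (show s.eval c = 0 by nlinarith [mul_self_nonneg (a.eval c)])
    obtain ⟨b, rfl⟩ := dvd_iff_isRoot.2 ha
    exact ⟨b * b + q, .sq_add b hq, by ring⟩

theorem IsSumSq.pow_dvd_left {p q : ℝ[X]} (hp : IsSumSq p) (hq : IsSumSq q) {c : ℝ} {n : ℕ}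
    (h : (X - C c) ^ n ∣ p + q) : (X - C c) ^ n ∣ p := by
  induction n using Nat.strong_induction_on generalizing p q with
  | _ n ih =>
    rcases n.eq_zero_or_pos with rfl | hn
    · simp
    have hroot : (p + q).IsRoot c :=
      dvd_iff_isRoot.1 ((dvd_pow_self _ hn.ne').trans h)
    have h0 : p.eval c + q.eval c = 0 := by simpa using hroot
    have h1 := IsSumSq.eval_nonneg hp c
    have h2 := IsSumSq.eval_nonneg hq c
    obtain ⟨p', hp', rfl⟩ := IsSumSq.exists_eq_of_isRoot hp (show p.eval c = 0 by linarith)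
    obtain ⟨q', hq', rfl⟩ := IsSumSq.exists_eq_of_isRoot hq (show q.eval c = 0 by linarith)
    rcases Nat.lt_or_ge n 2 with h | h2
    · exact (pow_dvd_pow _ h.le).mul_right _
    obtain ⟨m, rfl⟩ := Nat.exists_eq_add_of_le h2
    rw [← mul_add, pow_add] at h
    rw [pow_add]
    have hne : (X - C c) ^ 2 ≠ 0 := pow_ne_zero _ (X_sub_C_ne_zero c)
    exact mul_dvd_mul_left _ (ih m (by omega) hp' hq' ((mul_dvd_mul_iff_left hne).1 h))

theorem IsSumSq.pow_even_dvd {p : ℝ[X]} (hp : IsSumSq p) {c : ℝ} {k : ℕ}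
    (h : (X - C c) ^ (2 * k + 1) ∣ p) : (X - C c) ^ (2 * k + 2) ∣ p := by
  induction k generalizing p with
  | zero =>
    obtain ⟨q, -, rfl⟩ := IsSumSq.exists_eq_of_isRoot hp (dvd_iff_isRoot.1 (by simpa using h))
    simp
  | succ k ih =>
    obtain ⟨q, hq, rfl⟩ := IsSumSq.exists_eq_of_isRoot hp
      (dvd_iff_isRoot.1 ((dvd_pow_self _ (by omega)).trans h))
    have hne : (X - C c) ^ 2 ≠ 0 := pow_ne_zero _ (X_sub_C_ne_zero c)
    rw [show 2 * (k + 1) + 1 = 2 + (2 * k + 1) by ring, pow_add, mul_dvd_mul_iff_left hne] at h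
    rw [show 2 * (k + 1) + 2 = 2 + (2 * k + 2) by ring, pow_add]
    exact mul_dvd_mul_left _ (ih hq h)

theorem IsSumSq.eq_zero_of_add_eq_zero {p q : ℝ[X]} (hp : IsSumSq p) (hq : IsSumSq q)
    (h : p + q = 0) : p = 0 := by
  refine Polynomial.funext fun c => ?_
  have h0 : p.eval c + q.eval c = 0 := by simpa using congrArg (eval c) h
  have h1 := IsSumSq.eval_nonneg hp c
  have h2 := IsSumSq.eval_nonneg hq c
  rw [eval_zero]
  linarith

/-- The left-hand side of the Heilmann-Lieb identity for the vertices `u`, `v`. -/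
noncomputable def heilmannLieb (G : SimpleGraph V) (S : Finset V) (u v : V) : ℝ[X] :=
  polyOn G (S.erase u) * polyOn G (S.erase v) - polyOn G S * polyOn G ((S.erase u).erase v)

/-- The analogue of `heilmannLieb` for a vertex `w` and a pair of vertices `u`, `v`. -/
noncomputable def heilmannLiebPair (G : SimpleGraph V) (S : Finset V) (w u v : V) : ℝ[X] :=
  polyOn G (S.erase w) * polyOn G ((S.erase u).erase v) -
    polyOn G S * polyOn G (((S.erase w).erase u).erase v)

/-- The Wronskian of the matching polynomials on `S` and on `S` with `u` removed. -/
noncomputable def wronskianOn (G : SimpleGraph V) (S : Finset V) (u : V) : ℝ[X] :=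
  polyOn G (S.erase u) * derivative (polyOn G S) - derivative (polyOn G (S.erase u)) * polyOn G S

theorem heilmannLieb_eq (hu : u ∈ S) (hv : v ∈ S) (huv : u ≠ v) :
    heilmannLieb G S u v = (if G.Adj u v then polyOn G ((S.erase u).erase v) ^ 2 else 0) +
      ∑ i ∈ (nbrsIn G S u).erase v, heilmannLieb G (S.erase u) i v := by
  have h1 := polyOn_eq (G := G) (Finset.mem_erase.2 ⟨huv, hu⟩ : u ∈ S.erase v)
  rw [nbrsIn_erase, Finset.erase_right_comm] at h1
  have h2 := polyOn_eq (G := G) hu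
  rw [sum_nbrsIn hv] at h2
  have h3 : ∀ i, polyOn G (((S.erase u).erase v).erase i) =
      polyOn G (((S.erase u).erase i).erase v) := fun i => by rw [Finset.erase_right_comm]
  simp only [h3] at h1
  simp only [heilmannLieb, Finset.sum_sub_distrib, ← Finset.mul_sum, ← Finset.sum_mul]
  rw [h1, h2]
  split_ifs <;> ring

theorem heilmannLiebPair_eq {a : V} (hw : w ∈ S) (hu : u ∈ S) (ha : a ∈ S) (hwu : w ≠ u)
    (hwa : w ≠ a) (hua : u ≠ a) :
    heilmannLiebPair G S w u a =
      (if G.Adj w u then polyOn G ((S.erase w).erase u) *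
        polyOn G (((S.erase w).erase u).erase a) else 0) +
      ((if G.Adj w a then polyOn G ((S.erase w).erase a) *
        polyOn G (((S.erase w).erase u).erase a) else 0) +
      ∑ i ∈ ((nbrsIn G S w).erase u).erase a, heilmannLiebPair G (S.erase w) i u a) := by
  have h1 := polyOn_eq (G := G)
    (Finset.mem_erase.2 ⟨hwa, Finset.mem_erase.2 ⟨hwu, hw⟩⟩ : w ∈ (S.erase u).erase a)
  rw [nbrsIn_erase, nbrsIn_erase, Finset.erase_right_comm (a := a) (b := w),
    Finset.erase_right_comm (a := u) (b := w)] at h1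
  have h2 := polyOn_eq (G := G) hw
  rw [sum_nbrsIn hu, ← nbrsIn_erase, sum_nbrsIn (Finset.mem_erase.2 ⟨hua.symm, ha⟩),
    nbrsIn_erase] at h2
  have h3 : ∀ i, polyOn G ((((S.erase w).erase u).erase a).erase i) =
      polyOn G ((((S.erase w).erase i).erase u).erase a) := fun i => by
    rw [Finset.erase_right_comm, Finset.erase_right_comm (a := u)]
  simp only [h3] at h1
  simp only [heilmannLiebPair, Finset.sum_sub_distrib, ← Finset.mul_sum, ← Finset.sum_mul]
  rw [h1, h2]
  split_ifs <;> ring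

theorem wronskianOn_eq (hu : u ∈ S) :
    wronskianOn G S u = polyOn G (S.erase u) ^ 2 +
      ∑ i ∈ nbrsIn G S u, wronskianOn G (S.erase u) i := by
  have h2 := polyOn_eq (G := G) hu
  have h3 := congrArg derivative h2
  rw [derivative_sub, derivative_mul, derivative_X, derivative_sum] at h3
  simp only [wronskianOn, Finset.sum_sub_distrib, ← Finset.sum_mul]
  rw [h3, h2]
  ring

theorem isSumSq_heilmannLieb (hu : u ∈ S) (hv : v ∈ S) (huv : u ≠ v) :
    IsSumSq (heilmannLieb G S u v) := by
  induction S using Finset.strongInduction generalizing u with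
  | _ S ih =>
    rw [heilmannLieb_eq hu hv huv]
    refine IsSumSq.add ?_ (IsSumSq.sum fun i hi => ?_)
    · split_ifs
      exacts [(IsSquare.sq _).isSumSq, .zero]
    · obtain ⟨hiv, hi⟩ := Finset.mem_erase.1 hi
      obtain ⟨hi, hui⟩ := mem_nbrsIn.1 hi
      exact ih _ (Finset.erase_ssubset hu) (Finset.mem_erase.2 ⟨hui.ne', hi⟩)
        (Finset.mem_erase.2 ⟨huv.symm, hv⟩) hiv

theorem isSumSq_wronskianOn (hu : u ∈ S) : IsSumSq (wronskianOn G S u) := by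
  induction S using Finset.strongInduction generalizing u with
  | _ S ih =>
    rw [wronskianOn_eq hu]
    refine IsSumSq.add (IsSquare.sq _).isSumSq (IsSumSq.sum fun i hi => ?_)
    obtain ⟨hi, hui⟩ := mem_nbrsIn.1 hi
    exact ih _ (Finset.erase_ssubset hu) (Finset.mem_erase.2 ⟨hui.ne', hi⟩)

theorem isSumSq_sum_wronskianOn (G : SimpleGraph V) (S : Finset V) (u : V) :
    IsSumSq (∑ i ∈ nbrsIn G S u, wronskianOn G (S.erase u) i) := by
  refine IsSumSq.sum fun i hi => ?_
  obtain ⟨hi, hui⟩ := mem_nbrsIn.1 hi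
  exact isSumSq_wronskianOn (Finset.mem_erase.2 ⟨hui.ne', hi⟩)

theorem isSumSq_heilmannLieb_erase {i : V} (hv : v ∈ S) (huv : u ≠ v)
    (hi : i ∈ (nbrsIn G S u).erase v) : IsSumSq (heilmannLieb G (S.erase u) i v) := by
  obtain ⟨hiv, hi⟩ := Finset.mem_erase.1 hi
  obtain ⟨hi, hui⟩ := mem_nbrsIn.1 hi
  exact isSumSq_heilmannLieb (Finset.mem_erase.2 ⟨hui.ne', hi⟩)
    (Finset.mem_erase.2 ⟨huv.symm, hv⟩) hiv

theorem pow_dvd_heilmannLieb_erase {c : ℝ} {n : ℕ} {i : V} (hu : u ∈ S) (hv : v ∈ S) (huv : u ≠ v)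
    (h : (X - C c) ^ n ∣ heilmannLieb G S u v) (hi : i ∈ (nbrsIn G S u).erase v) :
    (X - C c) ^ n ∣ heilmannLieb G (S.erase u) i v := by
  rw [heilmannLieb_eq hu hv huv, ← Finset.add_sum_erase _ _ hi, add_left_comm] at h
  refine IsSumSq.pow_dvd_left (isSumSq_heilmannLieb_erase hv huv hi) (IsSumSq.add ?_ ?_) h
  · split_ifs
    exacts [(IsSquare.sq _).isSumSq, .zero]
  · exact IsSumSq.sum fun j hj =>
      isSumSq_heilmannLieb_erase hv huv (Finset.mem_of_mem_erase hj)

theorem pow_dvd_sq_of_pow_dvd_heilmannLieb {c : ℝ} {n : ℕ} (hu : u ∈ S) (hv : v ∈ S)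
    (huv : G.Adj u v) (h : (X - C c) ^ n ∣ heilmannLieb G S u v) :
    (X - C c) ^ n ∣ polyOn G ((S.erase u).erase v) ^ 2 := by
  rw [heilmannLieb_eq hu hv huv.ne, if_pos huv] at h
  exact IsSumSq.pow_dvd_left (IsSquare.sq _).isSumSq
    (IsSumSq.sum fun j hj => isSumSq_heilmannLieb_erase hv huv.ne hj) h

theorem pow_dvd_of_pow_two_mul_dvd_sq {c : ℝ} {k : ℕ} {p : ℝ[X]}
    (h : (X - C c) ^ (2 * k) ∣ p ^ 2) : (X - C c) ^ k ∣ p := by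
  rw [mul_comm, pow_mul] at h
  exact (IsIntegrallyClosed.pow_dvd_pow_iff two_ne_zero).1 h

theorem pow_dvd_heilmannLiebPair {c : ℝ} {k : ℕ} {a : V} (hw : w ∈ S) (hu : u ∈ S) (ha : a ∈ S)
    (hwu : w ≠ u) (hwa : w ≠ a) (hua : u ≠ a)
    (h1 : (X - C c) ^ (2 * k) ∣ heilmannLieb G S w u)
    (h2 : (X - C c) ^ (2 * k) ∣ heilmannLieb G (S.erase a) w u)
    (h3 : (X - C c) ^ (2 * k) ∣ heilmannLieb G S w a)
    (h4 : (X - C c) ^ (2 * k) ∣ heilmannLieb G (S.erase u) w a) :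
    (X - C c) ^ (2 * k) ∣ heilmannLiebPair G S w u a := by
  induction S using Finset.strongInduction generalizing w with
  | _ S ih =>
    have hwSa : w ∈ S.erase a := Finset.mem_erase.2 ⟨hwa, hw⟩
    have hwSu : w ∈ S.erase u := Finset.mem_erase.2 ⟨hwu, hw⟩
    have huSa : u ∈ S.erase a := Finset.mem_erase.2 ⟨hua, hu⟩
    have haSu : a ∈ S.erase u := Finset.mem_erase.2 ⟨hua.symm, ha⟩
    rw [heilmannLiebPair_eq hw hu ha hwu hwa hua]
    refine dvd_add ?_ (dvd_add ?_ (Finset.dvd_sum fun i hi => ?_))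
    · split_ifs with h
      · have e1 := pow_dvd_of_pow_two_mul_dvd_sq (pow_dvd_sq_of_pow_dvd_heilmannLieb hw hu h h1)
        have e2 := pow_dvd_of_pow_two_mul_dvd_sq (pow_dvd_sq_of_pow_dvd_heilmannLieb hwSa huSa h h2)
        rw [Finset.erase_right_comm (a := a), Finset.erase_right_comm (a := a)] at e2
        rw [two_mul, pow_add]
        exact mul_dvd_mul e1 e2
      · exact dvd_zero _
    · split_ifs with h
      · have e1 := pow_dvd_of_pow_two_mul_dvd_sq (pow_dvd_sq_of_pow_dvd_heilmannLieb hw ha h h3)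
        have e2 := pow_dvd_of_pow_two_mul_dvd_sq (pow_dvd_sq_of_pow_dvd_heilmannLieb hwSu haSu h h4)
        rw [Finset.erase_right_comm (a := u)] at e2
        rw [two_mul, pow_add]
        exact mul_dvd_mul e1 e2
      · exact dvd_zero _
    · obtain ⟨hia, hi⟩ := Finset.mem_erase.1 hi
      obtain ⟨hiu, hi⟩ := Finset.mem_erase.1 hi
      have hwi := (mem_nbrsIn.1 hi).2
      have hiS := (mem_nbrsIn.1 hi).1
      have m1 : i ∈ (nbrsIn G S w).erase u := Finset.mem_erase.2 ⟨hiu, hi⟩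
      have m3 : i ∈ (nbrsIn G S w).erase a := Finset.mem_erase.2 ⟨hia, hi⟩
      have m2 : i ∈ (nbrsIn G (S.erase a) w).erase u := by
        rw [nbrsIn_erase]
        exact Finset.mem_erase.2 ⟨hiu, m3⟩
      have m4 : i ∈ (nbrsIn G (S.erase u) w).erase a := by
        rw [nbrsIn_erase]
        exact Finset.mem_erase.2 ⟨hia, m1⟩
      refine ih _ (Finset.erase_ssubset hw) (Finset.mem_erase.2 ⟨hwi.ne', hiS⟩)
        (Finset.mem_erase.2 ⟨hwu.symm, hu⟩) (Finset.mem_erase.2 ⟨hwa.symm, ha⟩) hiu hia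
        (pow_dvd_heilmannLieb_erase hw hu hwu h1 m1) ?_
        (pow_dvd_heilmannLieb_erase hw ha hwa h3 m3) ?_
      · rw [Finset.erase_right_comm]
        exact pow_dvd_heilmannLieb_erase hwSa huSa hwu h2 m2
      · rw [Finset.erase_right_comm]
        exact pow_dvd_heilmannLieb_erase hwSu haSu hwa h4 m4

theorem polyOn_empty (G : SimpleGraph V) : polyOn G ∅ = 1 := by
  have h : matchingsIn G ∅ = {∅} := by
    ext M
    rw [Finset.mem_singleton]
    constructor
    · intro hM
      simpa using two_mul_card_le hM
    · rintro rfl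
      simp [mem_matchingsIn]
  simp [polyOn, h]

theorem polyOn_ne_zero (G : SimpleGraph V) (S : Finset V) : polyOn G S ≠ 0 := by
  induction S using Finset.strongInduction with
  | _ S ih =>
    rcases S.eq_empty_or_nonempty with rfl | ⟨u, hu⟩
    · rw [polyOn_empty]
      exact one_ne_zero
    · intro h
      have hw := wronskianOn_eq (G := G) hu
      rw [wronskianOn, h, derivative_zero, mul_zero, mul_zero, sub_zero] at hw
      exact pow_ne_zero 2 (ih _ (Finset.erase_ssubset hu))
        (IsSumSq.eq_zero_of_add_eq_zero (IsSquare.sq _).isSumSq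
          (isSumSq_sum_wronskianOn G S u) hw.symm)

/-- The multiplicity of `θ` as a root of the matching polynomial on `S`. -/
noncomputable def multOn (θ : ℝ) (G : SimpleGraph V) (S : Finset V) : ℕ :=
  (polyOn G S).rootMultiplicity θ

variable {θ : ℝ} {a : V}

theorem pow_dvd_polyOn_iff {n : ℕ} : (X - C θ) ^ n ∣ polyOn G S ↔ n ≤ multOn θ G S :=
  (le_rootMultiplicity_iff (polyOn_ne_zero G S)).symm

theorem pow_dvd_polyOn_mul_iff {n : ℕ} {T : Finset V} :
    (X - C θ) ^ n ∣ polyOn G S * polyOn G T ↔ n ≤ multOn θ G S + multOn θ G T := by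
  have h := mul_ne_zero (polyOn_ne_zero G S) (polyOn_ne_zero G T)
  rw [multOn, multOn, ← rootMultiplicity_mul h, le_rootMultiplicity_iff h]

theorem pow_dvd_heilmannLieb {n : ℕ} (h1 : n ≤ multOn θ G (S.erase u) + multOn θ G (S.erase v))
    (h2 : n ≤ multOn θ G S + multOn θ G ((S.erase u).erase v)) :
    (X - C θ) ^ n ∣ heilmannLieb G S u v :=
  dvd_sub (pow_dvd_polyOn_mul_iff.2 h1) (pow_dvd_polyOn_mul_iff.2 h2)

theorem multOn_le_multOn_erase_add_one (θ : ℝ) (G : SimpleGraph V) (hu : u ∈ S) :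
    multOn θ G S ≤ multOn θ G (S.erase u) + 1 := by
  by_contra! h
  set j := multOn θ G (S.erase u) with hj
  have h1 : (X - C θ) ^ j ∣ polyOn G (S.erase u) := pow_dvd_polyOn_iff.2 le_rfl
  have h2 : (X - C θ) ^ (j + 2) ∣ polyOn G S := pow_dvd_polyOn_iff.2 h
  have h3 := pow_sub_one_dvd_derivative_of_pow_dvd h2
  rw [Nat.add_succ_sub_one] at h3
  have h4 : (X - C θ) ^ (j - 1) ∣ derivative (polyOn G (S.erase u)) :=
    pow_sub_one_dvd_derivative_of_pow_dvd h1
  have h5 : (X - C θ) ^ (2 * j + 1) ∣ wronskianOn G S u := by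
    refine dvd_sub ?_ ?_
    · rw [show 2 * j + 1 = j + (j + 1) by ring, pow_add]
      exact mul_dvd_mul h1 h3
    · refine (pow_dvd_pow _ (by omega : 2 * j + 1 ≤ (j - 1) + (j + 2))).trans ?_
      rw [pow_add]
      exact mul_dvd_mul h4 h2
  rw [wronskianOn_eq hu] at h5
  have h6 := IsSumSq.pow_even_dvd (IsSquare.sq _).isSumSq
    (IsSumSq.pow_dvd_left (IsSquare.sq _).isSumSq (isSumSq_sum_wronskianOn G S u) h5)
  rw [← mul_add_one] at h6
  have h7 := pow_dvd_polyOn_iff.1 (pow_dvd_of_pow_two_mul_dvd_sq h6)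
  omega

theorem multOn_erase_le_multOn_add_one (θ : ℝ) (G : SimpleGraph V) (hu : u ∈ S) :
    multOn θ G (S.erase u) ≤ multOn θ G S + 1 := by
  suffices h : multOn θ G (S.erase u) - 1 ≤ multOn θ G S by omega
  rw [← pow_dvd_polyOn_iff, polyOn_eq hu]
  refine dvd_sub (dvd_mul_of_dvd_right (pow_dvd_polyOn_iff.2 (Nat.sub_le _ _)) _)
    (Finset.dvd_sum fun i hi => pow_dvd_polyOn_iff.2 ?_)
  obtain ⟨hi, hui⟩ := mem_nbrsIn.1 hi
  have := multOn_le_multOn_erase_add_one θ G (Finset.mem_erase.2 ⟨hui.ne', hi⟩ : i ∈ S.erase u)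
  omega

/-- A vertex which is not `θ`-essential but has a `θ`-essential neighbour is `θ`-positive. -/
theorem multOn_erase_eq_add_one (ha : a ∈ S) (hw : w ∈ S) (haw : G.Adj a w)
    (ha' : multOn θ G (S.erase a) + 1 ≠ multOn θ G S)
    (hw' : multOn θ G (S.erase w) + 1 = multOn θ G S) :
    multOn θ G (S.erase a) = multOn θ G S + 1 := by
  have b1 := multOn_le_multOn_erase_add_one θ G ha
  have b2 := multOn_erase_le_multOn_add_one θ G ha
  have b3 := multOn_le_multOn_erase_add_one θ G (Finset.mem_erase.2 ⟨haw.ne', hw⟩ : w ∈ S.erase a)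
  by_contra hne
  obtain ⟨k, hk⟩ : ∃ k, multOn θ G (S.erase w) = k := ⟨_, rfl⟩
  have h1 : (X - C θ) ^ (2 * k + 1) ∣ heilmannLieb G S a w :=
    pow_dvd_heilmannLieb (by omega) (by omega)
  have h2 := pow_dvd_polyOn_iff.1 (pow_dvd_of_pow_two_mul_dvd_sq (k := k + 1)
    (IsSumSq.pow_even_dvd (IsSquare.sq _).isSumSq
      (pow_dvd_sq_of_pow_dvd_heilmannLieb ha hw haw h1)))
  have h3 := IsSumSq.pow_even_dvd (isSumSq_heilmannLieb ha hw haw.ne) h1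
  have h4 : (X - C θ) ^ (2 * k + 2) ∣ polyOn G S * polyOn G ((S.erase a).erase w) :=
    pow_dvd_polyOn_mul_iff.2 (by omega)
  have h5 := pow_dvd_polyOn_mul_iff.1 ((dvd_sub_left h4).1 h3)
  omega

theorem multOn_erase_erase_ne (ha : a ∈ S) (hu : u ∈ S) (hw : w ∈ S) (hau : a ≠ u)
    (haw : G.Adj a w) (ha' : multOn θ G (S.erase a) = multOn θ G S + 1)
    (hu' : multOn θ G (S.erase u) = multOn θ G S + 1)
    (hw' : multOn θ G (S.erase w) + 1 = multOn θ G S) :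
    multOn θ G ((S.erase a).erase u) ≠ multOn θ G S := by
  intro h
  have hwu : w ≠ u := by
    rintro rfl
    omega
  have hwa : w ≠ a := haw.ne'
  have haSu : a ∈ S.erase u := Finset.mem_erase.2 ⟨hau, ha⟩
  have hwSu : w ∈ S.erase u := Finset.mem_erase.2 ⟨hwu, hw⟩
  have huSa : u ∈ S.erase a := Finset.mem_erase.2 ⟨hau.symm, hu⟩
  have hwSa : w ∈ S.erase a := Finset.mem_erase.2 ⟨hwa, hw⟩
  have haSw : a ∈ S.erase w := Finset.mem_erase.2 ⟨hwa.symm, ha⟩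
  have huSw : u ∈ S.erase w := Finset.mem_erase.2 ⟨hwu.symm, hu⟩
  have b1 := multOn_le_multOn_erase_add_one θ G hwSa
  have b2 := multOn_erase_le_multOn_add_one θ G haSw
  have b3 := multOn_le_multOn_erase_add_one θ G hwSu
  have b4 := multOn_erase_le_multOn_add_one θ G huSw
  have b5 := multOn_le_multOn_erase_add_one θ G
    (Finset.mem_erase.2 ⟨hwu, hwSa⟩ : w ∈ (S.erase a).erase u)
  have e1 : (S.erase u).erase a = (S.erase a).erase u := Finset.erase_right_comm
  have e2 : (S.erase w).erase a = (S.erase a).erase w := Finset.erase_right_comm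
  have e3 : (S.erase w).erase u = (S.erase u).erase w := Finset.erase_right_comm
  have e4 : ((S.erase a).erase w).erase u = ((S.erase a).erase u).erase w :=
    Finset.erase_right_comm
  have e5 : ((S.erase u).erase w).erase a = ((S.erase a).erase u).erase w := by
    rw [Finset.erase_right_comm, e1]
  rw [e2] at b2
  rw [e3] at b4
  obtain ⟨k, hk⟩ : ∃ k, multOn θ G S = k := ⟨_, rfl⟩
  have h1 : (X - C θ) ^ (2 * k) ∣ heilmannLieb G (S.erase u) a w :=
    pow_dvd_heilmannLieb (by rw [e1]; omega) (by rw [e1]; omega)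
  have h2 := pow_dvd_polyOn_iff.1 (pow_dvd_of_pow_two_mul_dvd_sq
    (pow_dvd_sq_of_pow_dvd_heilmannLieb haSu hwSu haw h1))
  rw [e1] at h2
  have h3 : (X - C θ) ^ (2 * k) ∣ heilmannLiebPair G S w u a := by
    refine pow_dvd_heilmannLiebPair hw hu ha hwu hwa hau.symm ?_ ?_ ?_ ?_
    · exact pow_dvd_heilmannLieb (by omega) (by rw [e3]; omega)
    · exact pow_dvd_heilmannLieb (by omega) (by rw [e4]; omega)
    · exact pow_dvd_heilmannLieb (by omega) (by rw [e2]; omega)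
    · exact pow_dvd_heilmannLieb (by rw [e1]; omega) (by rw [e5]; omega)
  have h4 : (X - C θ) ^ (2 * k) ∣ polyOn G S * polyOn G (((S.erase w).erase u).erase a) :=
    pow_dvd_polyOn_mul_iff.2 (by rw [e3, e5]; omega)
  have h5 := pow_dvd_polyOn_mul_iff.1 ((dvd_sub_left h4).1 h3)
  rw [e1] at h5
  omega

/-- `u` is a `θ`-special vertex of the subgraph of `G` induced on `S`. -/
def IsSpecialOn (θ : ℝ) (G : SimpleGraph V) (S : Finset V) (u : V) : Prop :=
  u ∈ S ∧ multOn θ G (S.erase u) + 1 ≠ multOn θ G S ∧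
    ∃ w ∈ S, G.Adj u w ∧ multOn θ G (S.erase w) + 1 = multOn θ G S

theorem IsSpecialOn.multOn_erase (h : IsSpecialOn θ G S u) :
    multOn θ G (S.erase u) = multOn θ G S + 1 := by
  obtain ⟨hu, hu', w, hw, huw, hw'⟩ := h
  exact multOn_erase_eq_add_one hu hw huw hu' hw'

theorem IsSpecialOn.erase (ha : IsSpecialOn θ G S a) (hu : IsSpecialOn θ G S u) (hau : a ≠ u) :
    IsSpecialOn θ G (S.erase a) u := by
  have ha1 := ha.multOn_erase
  have hu1 := hu.multOn_erase
  obtain ⟨haS, -, w, hw, haw, hw'⟩ := ha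
  obtain ⟨huS, -, z, hz, huz, hz'⟩ := hu
  have h := multOn_erase_erase_ne haS huS hw hau haw ha1 hu1 hw'
  have hza : z ≠ a := by
    rintro rfl
    omega
  refine ⟨Finset.mem_erase.2 ⟨hau.symm, huS⟩, by omega, z, Finset.mem_erase.2 ⟨hza, hz⟩, huz, ?_⟩
  have b1 := multOn_le_multOn_erase_add_one θ G (Finset.mem_erase.2 ⟨hza, hz⟩ : z ∈ S.erase a)
  have b2 := multOn_erase_le_multOn_add_one θ G
    (Finset.mem_erase.2 ⟨hza.symm, haS⟩ : a ∈ S.erase z)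
  rw [Finset.erase_right_comm] at b2
  omega

theorem IsSpecialOn.sdiff {Y : Finset V} (hY : ∀ y ∈ Y, IsSpecialOn θ G S y)
    (hu : IsSpecialOn θ G S u) (huY : u ∉ Y) : IsSpecialOn θ G (S \ Y) u := by
  induction Y using Finset.induction_on generalizing u with
  | empty => simpa using hu
  | insert y Y hy ih =>
    rw [Finset.mem_insert, not_or] at huY
    have hY' : ∀ z ∈ Y, IsSpecialOn θ G S z := fun z hz => hY z (Finset.mem_insert_of_mem hz)
    rw [Finset.sdiff_insert]
    exact (ih hY' (hY y (Finset.mem_insert_self _ _)) hy).erase (ih hY' hu huY.2) (Ne.symm huY.1)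

theorem multOn_sdiff_le (θ : ℝ) (G : SimpleGraph V) {Y : Finset V} (hY : Y ⊆ S) :
    multOn θ G (S \ Y) ≤ multOn θ G S + Y.card := by
  induction Y using Finset.induction_on with
  | empty => simp
  | insert y Y hy ih =>
    obtain ⟨h1, h2⟩ := Finset.insert_subset_iff.1 hY
    have := multOn_erase_le_multOn_add_one θ G (Finset.mem_sdiff.2 ⟨h1, hy⟩ : y ∈ S \ Y)
    rw [Finset.sdiff_insert, Finset.card_insert_of_notMem hy]
    have := ih h2
    omega

theorem polyOn_union {T : Finset V} (hd : Disjoint S T) (h : ∀ i ∈ S, ∀ j ∈ T, ¬ G.Adj i j) :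
    polyOn G (S ∪ T) = polyOn G S * polyOn G T := by
  induction S using Finset.strongInduction with
  | _ S ih =>
    rcases S.eq_empty_or_nonempty with rfl | ⟨u, hu⟩
    · rw [polyOn_empty, Finset.empty_union, one_mul]
    have herase : ∀ (R : Finset V) {i : V}, i ∈ S → (R ∪ T).erase i = R.erase i ∪ T := by
      intro R i hi
      rw [Finset.erase_union_distrib, Finset.erase_eq_of_notMem (Finset.disjoint_left.1 hd hi)]
    have hsub : ∀ R ⊂ S, polyOn G (R ∪ T) = polyOn G R * polyOn G T := fun R hR =>
      ih R hR (hd.mono_left hR.1) fun i hi => h i (hR.1 hi)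
    have hn : nbrsIn G (S ∪ T) u = nbrsIn G S u := by
      ext i
      simp only [mem_nbrsIn, Finset.mem_union]
      have := h u hu i
      tauto
    rw [polyOn_eq (Finset.mem_union_left T hu), polyOn_eq hu, hn, herase _ hu,
      hsub _ (Finset.erase_ssubset hu), sub_mul, Finset.sum_mul, mul_assoc]
    congr 1
    refine Finset.sum_congr rfl fun i hi => ?_
    obtain ⟨hi, hui⟩ := mem_nbrsIn.1 hi
    rw [herase _ hi]
    exact hsub _ ((Finset.erase_subset _ _).trans_ssubset (Finset.erase_ssubset hu))

theorem multOn_union {T : Finset V} (hd : Disjoint S T) (h : ∀ i ∈ S, ∀ j ∈ T, ¬ G.Adj i j) :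
    multOn θ G (S ∪ T) = multOn θ G S + multOn θ G T := by
  rw [multOn, polyOn_union hd h,
    rootMultiplicity_mul (mul_ne_zero (polyOn_ne_zero G S) (polyOn_ne_zero G T))]
  rfl

/-- The vertices of a connected component, as a finset. -/
noncomputable def compVerts (c : G.ConnectedComponent) : Finset V :=
  Finset.univ.filter fun v => G.connectedComponentMk v = c

theorem mem_compVerts {c : G.ConnectedComponent} :
    v ∈ compVerts c ↔ G.connectedComponentMk v = c := by
  simp [compVerts]

theorem multOn_biUnion_compVerts (s : Finset G.ConnectedComponent) :
    multOn θ G (s.biUnion compVerts) = ∑ c ∈ s, multOn θ G (compVerts c) := by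
  induction s using Finset.induction_on with
  | empty =>
    rw [Finset.biUnion_empty, Finset.sum_empty, multOn, polyOn_empty, rootMultiplicity_eq_zero]
    simp
  | insert c s hc ih =>
    have hne : ∀ i ∈ compVerts c, ∀ j ∈ s.biUnion compVerts,
        G.connectedComponentMk i ≠ G.connectedComponentMk j := by
      intro i hi j hj h
      obtain ⟨d, hd, hj⟩ := Finset.mem_biUnion.1 hj
      rw [mem_compVerts.1 hi, mem_compVerts.1 hj] at h
      exact hc (h ▸ hd)
    rw [Finset.biUnion_insert, Finset.sum_insert hc, ← ih]
    refine multOn_union (Finset.disjoint_left.2 fun i hi hj => hne i hi i hj rfl) ?_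
    exact fun i hi j hj hij =>
      hne i hi j hj (SimpleGraph.ConnectedComponent.sound hij.reachable)

theorem multOn_univ (θ : ℝ) (G : SimpleGraph V) :
    multOn θ G Finset.univ = ∑ c : G.ConnectedComponent, multOn θ G (compVerts c) := by
  rw [← multOn_biUnion_compVerts]
  congr 1
  ext v
  simp [mem_compVerts]

theorem multOn_erase_add_one_eq_iff (θ : ℝ) (G : SimpleGraph V) (v : V) :
    multOn θ G (Finset.univ.erase v) + 1 = multOn θ G Finset.univ ↔
      multOn θ G ((compVerts (G.connectedComponentMk v)).erase v) + 1 =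
        multOn θ G (compVerts (G.connectedComponentMk v)) := by
  set K := compVerts (G.connectedComponentMk v) with hK
  have hv : v ∈ K := mem_compVerts.2 rfl
  have hadj : ∀ i ∈ K, ∀ j ∈ Kᶜ, ¬ G.Adj i j := by
    intro i hi j hj hij
    refine Finset.mem_compl.1 hj (mem_compVerts.2 ?_)
    rw [← mem_compVerts.1 hi]
    exact SimpleGraph.ConnectedComponent.sound hij.symm.reachable
  have hd : Disjoint K Kᶜ := disjoint_compl_right
  have h1 := multOn_union (θ := θ) hd hadj
  have h2 := multOn_union (θ := θ) (hd.mono_left (Finset.erase_subset v K))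
    fun i hi => hadj i (Finset.mem_of_mem_erase hi)
  rw [Finset.union_compl] at h1
  have h3 : K.erase v ∪ Kᶜ = Finset.univ.erase v := by
    rw [← Finset.union_compl K, Finset.erase_union_distrib,
      Finset.erase_eq_of_notMem (s := Kᶜ) (by simpa using hv)]
  rw [h3] at h2
  omega

theorem mult_eq_multOn {W : Type*} {H : SimpleGraph W} (f : H ↪g G) (hS : Set.range f = S) :
    mult θ H = multOn θ G S := by
  rw [mult, matchingPoly_eq_polyOn f S hS, multOn]

theorem mult_deleteVert {W : Type*} {H : SimpleGraph W} (f : H ↪g G) (hS : Set.range f = S)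
    (z : W) : mult θ (deleteVert H z) = multOn θ G (S.erase (f z)) := by
  refine mult_eq_multOn ((SimpleGraph.Embedding.induce _).trans f) ?_
  ext v
  rw [Finset.coe_erase, ← hS]
  constructor
  · rintro ⟨⟨y, hy⟩, rfl⟩
    exact ⟨⟨y, rfl⟩, fun h => hy (f.injective h)⟩
  · rintro ⟨⟨y, rfl⟩, hy⟩
    exact ⟨⟨y, fun h => hy (congrArg f h)⟩, rfl⟩

theorem isEssential_iff {W : Type*} {H : SimpleGraph W} (f : H ↪g G) (hS : Set.range f = S)
    (z : W) : IsEssential θ H z ↔ multOn θ G (S.erase (f z)) + 1 = multOn θ G S := by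
  rw [IsEssential, mult_deleteVert f hS, mult_eq_multOn f hS]

theorem isSpecial_iff {W : Type*} {H : SimpleGraph W} (f : H ↪g G) (hS : Set.range f = S)
    (z : W) : IsSpecial θ H z ↔ IsSpecialOn θ G S (f z) := by
  have hmem : ∀ y, f y ∈ S := fun y => Finset.mem_coe.1 (hS ▸ Set.mem_range_self y)
  simp only [IsSpecial, IsSpecialOn, isEssential_iff f hS]
  refine ⟨fun ⟨h1, w, h2, h3⟩ => ⟨hmem z, h1, f w, hmem w, f.map_adj_iff.2 h2, h3⟩, ?_⟩
  rintro ⟨-, h1, w, hw, h2, h3⟩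
  obtain ⟨w, rfl⟩ : w ∈ Set.range f := hS ▸ Finset.mem_coe.2 hw
  exact ⟨h1, w, f.map_adj_iff.1 h2, h3⟩

theorem multOn_compVerts_of_isCritical {c : G.ConnectedComponent}
    (hc : IsCritical θ (G.induce c.supp)) : multOn θ G (compVerts c) = 1 := by
  rw [← hc.2]
  refine (mult_eq_multOn (SimpleGraph.Embedding.induce _) ?_).symm
  rw [range_induce]
  ext v
  simp [mem_compVerts]

theorem numCritComponents_eq (θ : ℝ) (G : SimpleGraph V) : numCritComponents θ G =
    ∑ c ∈ Finset.univ.filter (fun c : G.ConnectedComponent => IsCritical θ (G.induce c.supp)),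
      multOn θ G (compVerts c) := by
  rw [Finset.sum_congr rfl fun c hc =>
    multOn_compVerts_of_isCritical (Finset.mem_filter.1 hc).2, numCritComponents,
    Nat.card_eq_fintype_card, Fintype.card_subtype, Finset.sum_const, smul_eq_mul, mul_one]

theorem numCritComponents_le_mult (θ : ℝ) (G : SimpleGraph V) :
    numCritComponents θ G ≤ multOn θ G Finset.univ := by
  rw [numCritComponents_eq, multOn_univ]
  exact Finset.sum_le_sum_of_subset (Finset.filter_subset _ _)

theorem isEssential_of_adj {z : V} (h : multOn θ G Finset.univ ≤ numCritComponents θ G)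
    (hzw : G.Adj z w) (hw : multOn θ G (Finset.univ.erase w) + 1 = multOn θ G Finset.univ) :
    multOn θ G (Finset.univ.erase z) + 1 = multOn θ G Finset.univ := by
  rw [multOn_erase_add_one_eq_iff] at hw ⊢
  have hzw' : G.connectedComponentMk z = G.connectedComponentMk w :=
    SimpleGraph.ConnectedComponent.sound hzw.reachable
  rw [hzw']
  set c := G.connectedComponentMk w
  by_cases hc : IsCritical θ (G.induce c.supp)
  · refine (isEssential_iff (SimpleGraph.Embedding.induce c.supp) ?_ ⟨z, hzw'⟩).1 (hc.1 _)
    rw [range_induce]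
    ext v
    simp [mem_compVerts]
  · rw [multOn_univ, numCritComponents_eq, ← Finset.sum_filter_add_sum_filter_not Finset.univ
      (fun c : G.ConnectedComponent => IsCritical θ (G.induce c.supp))] at h
    have h0 := Finset.sum_eq_zero_iff.1 (nonpos_iff_eq_zero.1 (add_le_iff_nonpos_right _ |>.1 h)) c
      (Finset.mem_filter.2 ⟨Finset.mem_univ _, hc⟩)
    omega

theorem range_univ {W : Type*} [Fintype W] (H : SimpleGraph W) :
    Set.range (SimpleGraph.Embedding.refl : H ↪g H) = (Finset.univ : Finset W) := by
  rw [Finset.coe_univ]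
  exact Set.range_id

theorem isSpecialOn_iff_mem_of_isBarrier {Y : Finset V} {x : V} (hxY : x ∉ Y)
    (hB : IsBarrier θ G (insert x Y : Finset V))
    (hP : positiveSet θ (deleteVert G x) = ∅) :
    IsSpecialOn θ G (Finset.univ.erase x) u ↔ u ∈ Y := by
  set H := deleteSet G (insert x Y : Finset V) with hH
  set S := Finset.univ.erase x with hS
  let f : H ↪g G := SimpleGraph.Embedding.induce _
  let g : deleteVert G x ↪g G := SimpleGraph.Embedding.induce _
  have hf : Set.range f = (S \ Y : Finset V) := by
    refine (range_induce _).trans ?_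
    ext v
    simp [hS]
  have hg : Set.range g = S := by
    refine (range_induce _).trans ?_
    ext v
    simp [hS]
  have hHuniv : multOn θ H Finset.univ = multOn θ G (S \ Y) := by
    rw [← mult_eq_multOn f hf, mult_eq_multOn SimpleGraph.Embedding.refl (range_univ H)]
  have hGuniv : mult θ G = multOn θ G Finset.univ :=
    mult_eq_multOn SimpleGraph.Embedding.refl (range_univ G)
  have hle := numCritComponents_le_mult θ H
  have hYS : Y ⊆ S := fun y hy =>
    Finset.mem_erase.2 ⟨fun h => hxY (h ▸ hy), Finset.mem_univ _⟩
  have hle2 := multOn_sdiff_le θ G hYS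
  have hle3 := multOn_erase_le_multOn_add_one θ G (Finset.mem_univ x)
  rw [IsBarrier, Set.ncard_coe_finset, Finset.card_insert_of_notMem hxY, hGuniv] at hB
  rw [← hS] at hle3
  change numCritComponents θ H = _ at hB
  have hYspecial : ∀ y ∈ Y, IsSpecialOn θ G S y := by
    intro y hy
    have h1 := multOn_sdiff_le θ G (Finset.erase_subset_erase y hYS)
    have h2 : S.erase y \ Y.erase y = S \ Y := by
      ext v
      simp only [Finset.mem_sdiff, Finset.mem_erase]
      by_cases hv : v = y
      · simp [hv, hy]
      · simp [hv]
    have h3 := Finset.card_erase_add_one hy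
    have h4 := multOn_erase_le_multOn_add_one θ G (hYS hy)
    rw [h2] at h1
    obtain ⟨y, rfl⟩ : y ∈ Set.range g := hg ▸ Finset.mem_coe.2 (hYS hy)
    rw [← isSpecial_iff g hg]
    by_contra hns
    have hmem : y ∈ positiveSet θ (deleteVert G x) := by
      refine ⟨?_, hns⟩
      rw [IsPositive, mult_deleteVert g hg, mult_eq_multOn g hg]
      omega
    rw [hP] at hmem
    exact hmem
  refine ⟨fun hu => ?_, hYspecial u⟩
  by_contra huY
  have hsp := hu.sdiff hYspecial huY
  obtain ⟨u, rfl⟩ : u ∈ Set.range f := hf ▸ Finset.mem_coe.2 hsp.1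
  rw [← isSpecial_iff f hf] at hsp
  rw [isSpecial_iff SimpleGraph.Embedding.refl (range_univ H)] at hsp
  obtain ⟨-, hne, w, -, huw, hw⟩ := hsp
  exact hne (isEssential_of_adj (by omega) huw hw)

end Matchings

/-- If X is a θ-barrier set, x ∈ X and P_θ(G\x) = ∅, then A_θ(G\x) = X \ {x}. -/
theorem stmt_6 {V : Type*} [Fintype V] (θ : ℝ) (G : SimpleGraph V) (X : Set V)
    (hX : IsBarrier θ G X) (x : V) (hx : x ∈ X)
    (hP : positiveSet θ (deleteVert G x) = ∅) :
    Subtype.val '' specialSet θ (deleteVert G x) = X \ {x} := by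
  classical
  obtain ⟨Z, rfl⟩ : ∃ Z : Finset V, (Z : Set V) = X := ⟨X.toFinite.toFinset, by simp⟩
  rw [← Finset.insert_erase (Finset.mem_coe.1 hx)] at hX
  let g : deleteVert G x ↪g G := SimpleGraph.Embedding.induce _
  have hg : Set.range g = (Finset.univ.erase x : Finset V) := by
    refine (range_induce _).trans ?_
    ext v
    simp
  have key : ∀ u, IsSpecialOn θ G (Finset.univ.erase x) u ↔ u ∈ Z.erase x := fun u =>
    isSpecialOn_iff_mem_of_isBarrier (Finset.notMem_erase x Z) (by convert hX) hP
  rw [← Finset.coe_erase]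
  ext u
  rw [Finset.mem_coe, ← key]
  constructor
  · rintro ⟨u, hu, rfl⟩
    exact (isSpecial_iff g hg u).1 hu
  · intro hu
    obtain ⟨u, rfl⟩ : u ∈ Set.range g := hg ▸ Finset.mem_coe.2 hu.1
    exact ⟨u, (isSpecial_iff g hg u).2 hu, rfl⟩

end MatchPoly
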